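/- Let c > 0, n₃ = ⌊(2c+1)/2⌋ + 1, and t ∈ (0,1). If λ is a real number with λ > (2n₃)² − 2c and F(λ) = 2cos(πt), then it is not the case that both F'(λ) = 0 and F''(λ) = 0; that is, every eigenvalue of H_t(c) lying in ((2n₃)² − 2c, ∞) has multiplicity less than 3 (multiplicity being the order of λ as a zero of F(·) − 2cos(πt)). -/

import Mathlib

/-- `lam` is an eigenvalue of the Mathieu-type operator `H_t(c)` with potential
`2ic·cos(2x)` on `[0,π]`, with boundary conditions `y(π) = e^{iπt} y(0)`,
`y'(π) = e^{iπt} y'(0)`. -/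
def mathieuEV (c t : ℝ) (lam : ℂ) : Prop :=
  ∃ y : ℝ → ℂ, ContDiff ℝ 2 y ∧ (∃ x ∈ Set.Icc (0 : ℝ) Real.pi, y x ≠ 0) ∧
    (∀ x ∈ Set.Icc (0 : ℝ) Real.pi,
      -(deriv (deriv y) x) + 2 * Complex.I * (c : ℂ) * Complex.cos (2 * (x : ℂ)) * y x
        = lam * y x) ∧
    y Real.pi = Complex.exp (Complex.I * (Real.pi : ℂ) * (t : ℂ)) * y 0 ∧
    deriv y Real.pi = Complex.exp (Complex.I * (Real.pi : ℂ) * (t : ℂ)) * deriv y 0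

abbrev L2Z := lp (fun _ : ℤ => ℝ) 2

namespace L2Z

theorem sq_hasSum (w : L2Z) : HasSum (fun k => (w k) ^ 2) (‖w‖ ^ 2) := by
  have := lp.hasSum_inner (𝕜 := ℝ) w w
  rw [real_inner_self_eq_norm_sq] at this
  simpa [sq] using this

theorem inner_hasSum (v w : L2Z) : HasSum (fun k => v k * w k) (inner ℝ v w) := by
  have := lp.hasSum_inner (𝕜 := ℝ) v w
  simpa [mul_comm] using this

theorem mem_of_summable {f : ℤ → ℝ} (h : Summable fun k => (f k) ^ 2) : Memℓp f 2 := by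
  apply memℓp_gen
  simpa using h

/-- restriction to an index set -/
noncomputable def cut (s : ℤ → Prop) (w : L2Z) : L2Z :=
  open Classical in
  ⟨fun k => if s k then w k else 0, mem_of_summable (by
    refine Summable.of_nonneg_of_le (fun k => sq_nonneg _) (fun k => ?_) (sq_hasSum w).summable
    split_ifs
    · exact le_rfl
    · simpa using sq_nonneg (w k))⟩

open Classical in
theorem cut_apply (s : ℤ → Prop) (w : L2Z) (k : ℤ) : cut s w k = if s k then w k else 0 := rfl

/-- shift -/
noncomputable def sh (n : ℤ) (w : L2Z) : L2Z :=
  ⟨fun k => w (k + n), mem_of_summable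
    ((Equiv.addRight n).summable_iff.mpr (sq_hasSum w).summable)⟩

theorem sh_apply (n : ℤ) (w : L2Z) (k : ℤ) : sh n w k = w (k + n) := rfl

theorem norm_sh (n : ℤ) (w : L2Z) : ‖sh n w‖ = ‖w‖ := by
  have h1 := sq_hasSum (sh n w)
  have h2 := (Equiv.addRight n).hasSum_iff.mpr (sq_hasSum w)
  have h3 := h1.unique h2
  exact (sq_eq_sq₀ (norm_nonneg _) (norm_nonneg _)).mp h3

theorem inner_sh (n : ℤ) (v w : L2Z) : inner ℝ (sh n v) w = inner ℝ v (sh (-n) w) := by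
  have h1 := inner_hasSum (sh n v) w
  have h2 := (Equiv.addRight n).hasSum_iff.mpr (inner_hasSum v (sh (-n) w))
  refine h1.unique ?_
  convert h2 using 2 with k
  simp [sh_apply]

/-- the antisymmetric off-diagonal part -/
noncomputable def B (c : ℝ) (w : L2Z) : L2Z := c • (sh (-1) w - sh 1 w)

theorem B_apply (c : ℝ) (w : L2Z) (k : ℤ) : B c w k = c * (w (k - 1) - w (k + 1)) := by
  show c • ((sh (-1) w) k - (sh 1 w) k) = _
  simp only [sh_apply, smul_eq_mul, sub_eq_add_neg]

theorem norm_B {c : ℝ} (hc : 0 < c) (w : L2Z) : ‖B c w‖ ≤ 2 * c * ‖w‖ := by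
  rw [B, norm_smul, Real.norm_of_nonneg hc.le]
  have := norm_sub_le (sh (-1) w) (sh 1 w)
  rw [norm_sh, norm_sh] at this
  nlinarith

theorem inner_B (c : ℝ) (v w : L2Z) : inner ℝ (B c v) w = - inner ℝ v (B c w) := by
  simp only [B, inner_smul_left, inner_smul_right, inner_sub_left, inner_sub_right, inner_sh]
  simp
  ring

theorem inner_cut (s : ℤ → Prop) (v w : L2Z) :
    inner ℝ (cut s v) w = inner ℝ (cut s v) (cut s w) := by
  refine (inner_hasSum (cut s v) w).unique ?_
  convert inner_hasSum (cut s v) (cut s w) using 2 with k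
  simp only [cut_apply]
  split_ifs <;> simp

theorem cut_add (s : ℤ → Prop) (v w : L2Z) : cut s (v + w) = cut s v + cut s w := by
  ext k
  simp only [cut_apply, lp.coeFn_add, Pi.add_apply]
  split_ifs <;> simp

theorem norm_cut (s : ℤ → Prop) (w : L2Z) : ‖cut s w‖ ≤ ‖w‖ := by
  have := hasSum_le (fun k => ?_) (sq_hasSum (cut s w)) (sq_hasSum w)
  · exact (sq_le_sq₀ (norm_nonneg _) (norm_nonneg _)).mp this
  · simp only [cut_apply]
    split_ifs
    · exact le_rfl
    · simpa using sq_nonneg (w k)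

theorem even_add_odd (w : L2Z) : cut Even w + cut Odd w = w := by
  ext k
  simp only [cut_apply, lp.coeFn_add, Pi.add_apply]
  rcases Int.even_or_odd k with h | h
  · simp [h]
  · simp [h, Int.not_even_iff_odd.mpr h]

theorem B_odd (c : ℝ) (w : L2Z) : B c (cut Odd w) = cut Even (B c w) := by
  ext k
  simp only [B_apply, cut_apply]
  rcases Int.even_or_odd k with h | h
  · simp [h, h.sub_odd odd_one, h.add_odd odd_one]
  · have h1 := h.sub_odd odd_one
    have h2 := h.add_odd odd_one
    simp [Int.not_even_iff_odd.mpr h, Int.not_odd_iff_even.mpr h1, Int.not_odd_iff_even.mpr h2]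

theorem B_even (c : ℝ) (w : L2Z) : B c (cut Even w) = cut Odd (B c w) := by
  ext k
  simp only [B_apply, cut_apply]
  rcases Int.even_or_odd k with h | h
  · have h1 := h.sub_odd odd_one
    have h2 := h.add_odd odd_one
    simp [Int.not_even_iff_odd.mpr h1, Int.not_even_iff_odd.mpr h2, Int.not_odd_iff_even.mpr h]
  · simp [h, h.sub_odd odd_one, h.add_odd odd_one]

/-- If `G = b E` then `b` is small somewhere on the support. -/
theorem exists_small {b : ℤ → ℝ} {E G : L2Z} (hG : ∀ k, G k = b k * E k) {r : ℝ} (hr : 0 ≤ r)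
    (hE : E ≠ 0) (h : ‖G‖ ≤ r * ‖E‖) : ∃ p, E p ≠ 0 ∧ |b p| ≤ r := by
  by_contra hcon
  push Not at hcon
  obtain ⟨p, hp⟩ : ∃ p, E p ≠ 0 := by
    by_contra h0
    push Not at h0
    exact hE (by ext k; simpa using h0 k)
  have h1 := sq_hasSum G
  have h2 := (sq_hasSum E).mul_left (r ^ 2)
  have : r ^ 2 * ‖E‖ ^ 2 < ‖G‖ ^ 2 := by
    refine hasSum_lt (i := p) (fun k => ?_) ?_ h2 h1
    · show r ^ 2 * E k ^ 2 ≤ G k ^ 2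
      rw [hG, mul_pow]
      by_cases hk : E k = 0
      · simp [hk]
      · have := hcon k hk
        rw [← sq_abs (b k)]
        gcongr
    · show r ^ 2 * E p ^ 2 < G p ^ 2
      rw [hG, mul_pow, ← sq_abs (b p)]
      have := hcon p hp
      gcongr
  have h3 : ‖G‖ ^ 2 ≤ (r * ‖E‖) ^ 2 := by gcongr
  nlinarith

theorem norm_far {b : ℤ → ℝ} {E G : L2Z} (hG : ∀ k, G k = b k * E k) {d : ℝ} (hd : 0 ≤ d) (p : ℤ)
    (h : ∀ k, k ≠ p → E k ≠ 0 → d ≤ |b k|) : d * ‖cut (· ≠ p) E‖ ≤ ‖cut (· ≠ p) G‖ := by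
  have h1 := sq_hasSum (cut (· ≠ p) G)
  have h2 := (sq_hasSum (cut (· ≠ p) E)).mul_left (d ^ 2)
  have : d ^ 2 * ‖cut (· ≠ p) E‖ ^ 2 ≤ ‖cut (· ≠ p) G‖ ^ 2 := by
    refine hasSum_le (fun k => ?_) h2 h1
    simp only [cut_apply]
    split_ifs with hk
    · rw [hG, mul_pow]
      by_cases h0 : E k = 0
      · simp [h0]
      · have := h k hk h0
        rw [← sq_abs (b k)]
        gcongr
    · simp
  rw [← mul_pow] at this
  exact (sq_le_sq₀ (by positivity) (norm_nonneg _)).mp this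

theorem norm_split (p : ℤ) (E : L2Z) : ‖E‖ ^ 2 = E p ^ 2 + ‖cut (· ≠ p) E‖ ^ 2 := by
  refine (sq_hasSum E).unique ?_
  have h1 := hasSum_ite_eq p (E p ^ 2)
  convert h1.add (sq_hasSum (cut (· ≠ p) E)) using 2 with k
  simp only [cut_apply]
  by_cases h : k = p <;> simp [h]

theorem inner_split (p : ℤ) (E X : L2Z) :
    inner ℝ E X = E p * X p + inner ℝ (cut (· ≠ p) E) (cut (· ≠ p) X) := by
  refine (inner_hasSum E X).unique ?_
  have h1 := hasSum_ite_eq p (E p * X p)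
  convert h1.add (inner_hasSum (cut (· ≠ p) E) (cut (· ≠ p) X)) using 2 with k
  simp only [cut_apply]
  by_cases h : k = p <;> simp [h]

theorem inner_b {b : ℤ → ℝ} {E G X Y : L2Z} (hG : ∀ k, G k = b k * E k)
    (hY : ∀ k, Y k = b k * X k) : inner ℝ G X = inner ℝ E Y := by
  refine (inner_hasSum G X).unique ?_
  convert inner_hasSum E Y using 2 with k
  rw [hG, hY]; ring

end L2Z

namespace L2Z

theorem half {b : ℤ → ℝ} {E X G Y : L2Z} {c N σ T : ℝ} (hc : 0 < c) (hN : 0 < N) (p : ℤ)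
    (hEN : ‖E‖ = N) (hG : ∀ k, G k = b k * E k) (hY : ∀ k, Y k = b k * X k)
    (hGn : ‖G‖ ≤ 2 * c * N)
    (hE : ∀ k, k ≠ p → E k ≠ 0 → 6 * c ≤ |b k|) (hX : ∀ k, k ≠ p → X k ≠ 0 → 6 * c ≤ |b k|)
    (hσ : |inner ℝ E X| ≤ σ)
    (hYn : ‖cut (· ≠ p) Y‖ ≤ ‖cut (· ≠ p) E‖ + T) :
    ‖X‖ ≤ (7 / 5) * (N / 3 + T) / (6 * c) + 2 * σ / N := by
  have h1 := norm_far hG (by positivity) p hE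
  have h2 := norm_far hY (by positivity) p hX
  have h3 := norm_cut (· ≠ p) G
  have h4 := norm_split p E
  have h5 := norm_split p X
  have h6 := inner_split p E X
  have h7 := abs_real_inner_le_norm (cut (· ≠ p) E) (cut (· ≠ p) X)
  set e := ‖cut (· ≠ p) E‖
  set x := ‖cut (· ≠ p) X‖
  have he0 : 0 ≤ e := norm_nonneg _
  have hx0 : 0 ≤ x := norm_nonneg _
  have he : e ≤ N / 3 := by
    have : 6 * c * e ≤ 2 * c * N := h1.trans (h3.trans hGn)
    have h8 : c * (6 * e) ≤ c * (2 * N) := by linarith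
    have := le_of_mul_le_mul_left h8 hc
    linarith
  have hEp : 9 / 10 * N ≤ |E p| := by
    rw [hEN] at h4
    apply le_of_sq_le_sq _ (abs_nonneg _)
    rw [sq_abs]
    nlinarith
  have hxb : x ≤ (N / 3 + T) / (6 * c) := by
    rw [le_div_iff₀ (by positivity)]
    linarith
  have hprod : |E p| * |X p| ≤ σ + N / 3 * x := by
    rw [← abs_mul]
    have : E p * X p = inner ℝ E X - inner ℝ (cut (· ≠ p) E) (cut (· ≠ p) X) := by linarith
    rw [this]
    refine (abs_sub _ _).trans ?_
    have : e * x ≤ N / 3 * x := by gcongr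
    linarith
  have hσ0 : 0 ≤ σ := (abs_nonneg _).trans hσ
  have hXp : |X p| ≤ 10 / 9 * (σ / N) + 10 / 27 * x := by
    have h9 : 9 / 10 * N * |X p| ≤ σ + N / 3 * x :=
      (mul_le_mul_of_nonneg_right hEp (abs_nonneg _)).trans hprod
    have : |X p| ≤ (σ + N / 3 * x) / (9 / 10 * N) := by
      rw [le_div_iff₀ (by positivity)]; linarith
    refine this.trans (le_of_eq ?_)
    field_simp
    ring
  have hXn : ‖X‖ ≤ |X p| + x := by
    apply le_of_sq_le_sq _ (by positivity)
    rw [h5, ← sq_abs (X p)]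
    nlinarith [mul_nonneg (abs_nonneg (X p)) hx0]
  have hs : 0 ≤ σ / N := by positivity
  have e1 : 7 / 5 * (N / 3 + T) / (6 * c) = 7 / 5 * ((N / 3 + T) / (6 * c)) := by ring
  have e2 : 2 * σ / N = 2 * (σ / N) := by ring
  rw [e1, e2]
  linarith

theorem core {c : ℝ} (hc : 0 < c) {b : ℤ → ℝ}
    (hsep : ∀ p q : ℤ, Even p → Odd q → |b p| ≤ 2 * c → |b q| ≤ 2 * c →
      ∀ k, k ≠ p → k ≠ q → 6 * c ≤ |b k|)
    {w : L2Z} (hw : w ≠ 0)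
    (hweq : ∀ k, b k * w k + B c w k = 0)
    (hww : ‖cut Even w‖ = ‖cut Odd w‖)
    (hv : ∀ τ > 0, ∃ v f : L2Z, ‖f‖ ≤ τ ∧
      |inner ℝ (cut Even w) (cut Even v) - inner ℝ (cut Odd w) (cut Odd v)| ≤ τ ∧
      ∀ k, b k * v k + B c v k = w k + f k) : False := by
  set E := cut Even w with hEdef
  set O := cut Odd w with hOdef
  have hN : 0 < ‖E‖ := by
    rcases (norm_nonneg E).lt_or_eq with h | h
    · exact h
    · exfalso
      apply hw
      rw [← even_add_odd w, ← hEdef, ← hOdef, norm_eq_zero.mp h.symm, norm_eq_zero.mp (hww.symm.trans h.symm)]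
      simp
  set N := ‖E‖ with hNdef
  have hON : ‖O‖ = N := hww.symm
  have hGE : ∀ k, (-(B c O)) k = b k * E k := by
    intro k
    rw [hOdef, hEdef, B_odd]
    simp only [lp.coeFn_neg, Pi.neg_apply, cut_apply]
    have := hweq k
    split_ifs <;> linarith
  have hGO : ∀ k, (-(B c E)) k = b k * O k := by
    intro k
    rw [hOdef, hEdef, B_even]
    simp only [lp.coeFn_neg, Pi.neg_apply, cut_apply]
    have := hweq k
    split_ifs <;> linarith
  have hGEn : ‖-(B c O)‖ ≤ 2 * c * N := by
    rw [norm_neg, ← hON]; exact norm_B hc O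
  have hGOn : ‖-(B c E)‖ ≤ 2 * c * N := by
    rw [norm_neg]; exact norm_B hc E
  have hE0 : E ≠ 0 := norm_pos_iff.mp hN
  have hO0 : O ≠ 0 := norm_pos_iff.mp (hON ▸ hN)
  obtain ⟨p, hp0, hp⟩ := exists_small hGE (by positivity) hE0 hGEn
  obtain ⟨q, hq0, hq⟩ := exists_small hGO (by positivity) hO0 (hON ▸ hGOn)
  have hpe : Even p := by
    by_contra h
    exact hp0 (by rw [hEdef, cut_apply, if_neg h])
  have hqo : Odd q := by
    by_contra h
    exact hq0 (by rw [hOdef, cut_apply, if_neg h])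
  have hfar := hsep p q hpe hqo hp hq
  have hfarE : ∀ X : L2Z, ∀ k, k ≠ p → cut Even X k ≠ 0 → 6 * c ≤ |b k| := by
    intro X k hk h0
    refine hfar k hk ?_
    rintro rfl
    exact h0 (by rw [cut_apply, if_neg (Int.not_even_iff_odd.mpr hqo)])
  have hfarO : ∀ X : L2Z, ∀ k, k ≠ q → cut Odd X k ≠ 0 → 6 * c ≤ |b k| := by
    intro X k hk h0
    refine hfar k ?_ hk
    rintro rfl
    exact h0 (by rw [cut_apply, if_neg (Int.not_odd_iff_even.mpr hpe)])
  obtain ⟨τ, hτ0, hτ1, hτ2⟩ : ∃ τ > 0, τ ≤ N / 20 ∧ τ ≤ N ^ 2 / (150 * c) :=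
    ⟨min (N / 20) (N ^ 2 / (150 * c)), by positivity, min_le_left _ _, min_le_right _ _⟩
  obtain ⟨v0, f, hf, hin, hveq0⟩ := hv τ hτ0
  obtain ⟨v, hEv, hOv, hveq⟩ : ∃ v : L2Z, inner ℝ E (cut Even v) = 0 ∧
      |inner ℝ O (cut Odd v)| ≤ τ ∧ ∀ k, b k * v k + B c v k = w k + f k := by
    set α := - inner ℝ E (cut Even v0) / N ^ 2
    have hαN : α * N ^ 2 = - inner ℝ E (cut Even v0) := by
      simp only [α]; field_simp
    have hsm : ∀ s, cut s (v0 + α • w) = cut s v0 + α • cut s w := by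
      intro s
      ext k
      simp only [cut_apply, lp.coeFn_add, lp.coeFn_smul, Pi.add_apply, Pi.smul_apply]
      split_ifs <;> simp
    refine ⟨v0 + α • w, ?_, ?_, ?_⟩
    · rw [hsm, inner_add_right, inner_smul_right, ← hEdef, real_inner_self_eq_norm_sq, ← hNdef]
      linarith
    · rw [hsm, inner_add_right, inner_smul_right, ← hOdef, real_inner_self_eq_norm_sq, hON, hαN]
      rw [abs_sub_comm] at hin
      exact hin
    · intro k
      have h1 := hveq0 k
      have h2 := hweq k
      simp only [B_apply, lp.coeFn_add, lp.coeFn_smul, Pi.add_apply, Pi.smul_apply,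
        smul_eq_mul] at h1 h2 ⊢
      linear_combination h1 + α * h2
  set X := cut Even v with hX
  set Z := cut Odd v with hZ
  have hYX : ∀ k, (E + cut Even f - B c Z) k = b k * X k := by
    intro k
    rw [hZ, hX, hEdef, B_odd]
    simp only [lp.coeFn_sub, lp.coeFn_add, Pi.add_apply, Pi.sub_apply, cut_apply]
    have := hveq k
    split_ifs <;> linarith
  have hYZ : ∀ k, (O + cut Odd f - B c X) k = b k * Z k := by
    intro k
    rw [hZ, hX, hOdef, B_even]
    simp only [lp.coeFn_sub, lp.coeFn_add, Pi.add_apply, Pi.sub_apply, cut_apply]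
    have := hveq k
    split_ifs <;> linarith
  have hcutsub : ∀ (s : ℤ → Prop) (U V W : L2Z), ‖cut s (U + V - W)‖ ≤ ‖cut s U‖ + (‖V‖ + ‖W‖) := by
    intro s U V W
    have h1 : cut s (U + V - W) = cut s U + cut s (V - W) := by
      rw [← cut_add, add_sub_assoc]
    rw [h1]
    refine (norm_add_le _ _).trans ?_
    have := (norm_cut s (V - W)).trans (norm_sub_le V W)
    linarith
  have hfE : ‖cut Even f‖ ≤ τ := (norm_cut _ _).trans hf
  have hfO : ‖cut Odd f‖ ≤ τ := (norm_cut _ _).trans hf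
  have hBZ := norm_B hc Z
  have hBX := norm_B hc X
  have hXb := half hc hN p rfl hGE hYX hGEn (hfarE w) (hfarE v) (σ := τ) (by rw [hEv]; simp; exact hτ0.le)
    (T := τ + 2 * c * ‖Z‖) ((hcutsub _ _ _ _).trans (by linarith))
  have hZb := half hc hN q hON hGO hYZ hGOn (hfarO w) (hfarO v) hOv
    (T := τ + 2 * c * ‖X‖) ((hcutsub _ _ _ _).trans (by linarith))
  -- the final contradiction
  have hfin : N ^ 2 = inner ℝ E (B c Z) - inner ℝ (B c O) X - inner ℝ E (cut Even f) := by
    have h1 := inner_b hGE hYX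
    rw [inner_neg_left, inner_sub_right, inner_add_right, real_inner_self_eq_norm_sq] at h1
    linarith
  have hfin2 : N ^ 2 ≤ N * (2 * c * ‖Z‖) + 2 * c * N * ‖X‖ + N * τ := by
    have h1 := abs_real_inner_le_norm E (B c Z)
    have h2 := abs_real_inner_le_norm (B c O) X
    have h3 := abs_real_inner_le_norm E (cut Even f)
    rw [← hNdef] at h1 h3
    rw [norm_neg] at hGEn
    have h4 : N * ‖B c Z‖ ≤ N * (2 * c * ‖Z‖) := by gcongr
    have h5 : ‖B c O‖ * ‖X‖ ≤ 2 * c * N * ‖X‖ := by gcongr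
    have h6 : N * ‖cut Even f‖ ≤ N * τ := by gcongr
    have := le_abs_self (inner ℝ E (B c Z))
    have := neg_abs_le (inner ℝ (B c O) X)
    have := neg_abs_le (inner ℝ E (cut Even f))
    linarith
  have hfin3 : N ≤ 2 * c * (‖X‖ + ‖Z‖) + τ := by
    have : N * N ≤ N * (2 * c * (‖X‖ + ‖Z‖) + τ) := by nlinarith
    exact le_of_mul_le_mul_left this hN
  have hsum : ‖X‖ + ‖Z‖ ≤ 7 / 5 * (2 * N / 3 + 2 * τ + 2 * c * (‖X‖ + ‖Z‖)) / (6 * c) + 4 * τ / N := by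
    have e : 7 / 5 * (2 * N / 3 + 2 * τ + 2 * c * (‖X‖ + ‖Z‖)) / (6 * c) + 4 * τ / N
      = (7 / 5 * (N / 3 + (τ + 2 * c * ‖Z‖)) / (6 * c) + 2 * τ / N) +
        (7 / 5 * (N / 3 + (τ + 2 * c * ‖X‖)) / (6 * c) + 2 * τ / N) := by ring
    rw [e]; linarith
  have hcs : 6 * (c * (‖X‖ + ‖Z‖)) ≤ 7 / 5 * (2 * N / 3 + 2 * τ + 2 * (c * (‖X‖ + ‖Z‖)))
      + 24 * (c * τ / N) := by
    have h := mul_le_mul_of_nonneg_left hsum (by positivity : 0 ≤ 6 * c)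
    have e : 6 * c * (7 / 5 * (2 * N / 3 + 2 * τ + 2 * c * (‖X‖ + ‖Z‖)) / (6 * c) + 4 * τ / N)
       = 7 / 5 * (2 * N / 3 + 2 * τ + 2 * (c * (‖X‖ + ‖Z‖))) + 24 * (c * τ / N) := by
      field_simp
      ring
    rw [e] at h
    linarith
  have hcτ : c * τ / N ≤ N / 150 := by
    rw [div_le_iff₀ hN]
    rw [le_div_iff₀ (by positivity)] at hτ2
    nlinarith
  linarith

end L2Z

namespace L2Z

theorem cut_smul (s : ℤ → Prop) (a : ℝ) (w : L2Z) : cut s (a • w) = a • cut s w := by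
  ext k
  simp only [cut_apply, lp.coeFn_smul, Pi.smul_apply]
  split_ifs <;> simp

/-- the indefinite form -/
noncomputable def kf (x y : L2Z) : ℝ :=
  inner ℝ (cut Even x) (cut Even y) - inner ℝ (cut Odd x) (cut Odd y)

theorem kf_add (x y z : L2Z) : kf x (y + z) = kf x y + kf x z := by
  simp only [kf, cut_add, inner_add_right]; ring

theorem kf_smul (x : L2Z) (a : ℝ) (y : L2Z) : kf x (a • y) = a * kf x y := by
  simp only [kf, cut_smul, inner_smul_right]; ring

theorem kf_abs (x y : L2Z) : |kf x y| ≤ 2 * (‖x‖ * ‖y‖) := by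
  unfold kf
  refine (abs_sub _ _).trans ?_
  have h1 := abs_real_inner_le_norm (cut Even x) (cut Even y)
  have h2 := abs_real_inner_le_norm (cut Odd x) (cut Odd y)
  have h3 : ‖cut Even x‖ * ‖cut Even y‖ ≤ ‖x‖ * ‖y‖ := by
    gcongr <;> exact norm_cut _ _
  have h4 : ‖cut Odd x‖ * ‖cut Odd y‖ ≤ ‖x‖ * ‖y‖ := by
    gcongr <;> exact norm_cut _ _
  linarith

theorem kf_zero {c : ℝ} {b : ℤ → ℝ} {w u g : L2Z}
    (hw : ∀ k, b k * w k + B c w k = 0) (hu : ∀ k, b k * u k + B c u k = g k) : kf w g = 0 := by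
  have h1 : ∀ k, (-(B c (cut Odd w))) k = b k * cut Even w k := by
    intro k
    rw [B_odd]
    simp only [lp.coeFn_neg, Pi.neg_apply, cut_apply]
    have := hw k
    split_ifs <;> linarith
  have h2 : ∀ k, (-(B c (cut Even w))) k = b k * cut Odd w k := by
    intro k
    rw [B_even]
    simp only [lp.coeFn_neg, Pi.neg_apply, cut_apply]
    have := hw k
    split_ifs <;> linarith
  have h3 : ∀ k, (cut Even g - (B c (cut Odd u))) k = b k * cut Even u k := by
    intro k
    rw [B_odd]
    simp only [lp.coeFn_sub, Pi.sub_apply, cut_apply]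
    have := hu k
    split_ifs <;> linarith
  have h4 : ∀ k, (cut Odd g - (B c (cut Even u))) k = b k * cut Odd u k := by
    intro k
    rw [B_even]
    simp only [lp.coeFn_sub, Pi.sub_apply, cut_apply]
    have := hu k
    split_ifs <;> linarith
  have i1 := inner_b h1 h3
  have i2 := inner_b h2 h4
  rw [inner_neg_left, inner_sub_right, inner_B] at i1 i2
  unfold kf
  linarith

theorem family {c : ℝ} (hc : 0 < c) {b : ℤ → ℝ}
    (hsep : ∀ p q : ℤ, Even p → Odd q → |b p| ≤ 2 * c → |b q| ≤ 2 * c →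
      ∀ k, k ≠ p → k ≠ q → 6 * c ≤ |b k|)
    {w : L2Z} (hw : w ≠ 0)
    (hweq : ∀ k, b k * w k + B c w k = 0)
    (hfam : ∀ τ > 0, ∃ ε : ℝ, ε ≠ 0 ∧ |ε| ≤ τ ∧ ∃ u r : L2Z, ‖u - w‖ ≤ τ ∧ ‖r‖ ≤ τ ∧
      ∀ k, b k * u k + B c u k = ε * u k + ε ^ 2 * r k) : False := by
  have huw : ∀ (ε : ℝ) (u r : L2Z), ε ≠ 0 →
      (∀ k, b k * u k + B c u k = ε * u k + ε ^ 2 * r k) → kf w u = - ε * kf w r := by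
    intro ε u r hε h
    have h1 : kf w (ε • u + ε ^ 2 • r) = 0 := kf_zero hweq (u := u) (by
      intro k
      rw [h k]
      rfl)
    rw [kf_add, kf_smul, kf_smul] at h1
    have : ε * kf w u = ε * (- ε * kf w r) := by linear_combination h1
    exact mul_left_cancel₀ hε this
  have hww0 : kf w w = 0 := by
    by_contra hne
    have hpos : 0 < |kf w w| := abs_pos.mpr hne
    have hwn : 0 < ‖w‖ := norm_pos_iff.mpr hw
    obtain ⟨ε, hε, hετ, u, r, hu, hr, h⟩ := hfam (min 1 (|kf w w| / (8 * ‖w‖))) (by positivity)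
    have h1 := huw ε u r hε h
    have h2 : kf w w = - ε * kf w r - kf w (u - w) := by
      rw [← h1]
      have := kf_add w w (u - w)
      rw [add_sub_cancel] at this
      linarith
    have h3 : |kf w w| ≤ |ε| * |kf w r| + |kf w (u - w)| := by
      calc |kf w w| = |- ε * kf w r - kf w (u - w)| := by rw [← h2]
        _ ≤ _ := (abs_sub _ _).trans (by rw [abs_mul, abs_neg])
    have h4 := kf_abs w r
    have h5 := kf_abs w (u - w)
    have hε1 := hετ.trans (min_le_left _ _)
    have hr1 := hr.trans (min_le_right _ _)
    have hu1 := hu.trans (min_le_right _ _)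
    rw [le_div_iff₀ (by positivity)] at hr1 hu1
    have h6 : |ε| * |kf w r| ≤ 1 * |kf w r| := by gcongr
    nlinarith
  have hww : ‖cut Even w‖ = ‖cut Odd w‖ := by
    rw [kf, real_inner_self_eq_norm_sq, real_inner_self_eq_norm_sq, sub_eq_zero] at hww0
    exact (sq_eq_sq₀ (norm_nonneg _) (norm_nonneg _)).mp hww0
  refine core hc hsep hw hweq hww fun τ hτ => ?_
  have hwn : 0 < ‖w‖ := norm_pos_iff.mpr hw
  obtain ⟨ε, hε, hετ, u, r, hu, hr, h⟩ :=
    hfam (min 1 (min (τ / 2) (τ / (2 * ‖w‖)))) (by positivity)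
  have h1 := huw ε u r hε h
  have hε1 := hετ.trans (min_le_left _ _)
  have hr1 := hr.trans ((min_le_right _ _).trans (min_le_left _ _))
  have hr2 := hr.trans ((min_le_right _ _).trans (min_le_right _ _))
  have hu1 := hu.trans ((min_le_right _ _).trans (min_le_left _ _))
  rw [le_div_iff₀ (by positivity)] at hr2
  refine ⟨ε⁻¹ • (u - w), (u - w) + ε • r, ?_, ?_, ?_⟩
  · refine (norm_add_le _ _).trans ?_
    rw [norm_smul, Real.norm_eq_abs]
    have : |ε| * ‖r‖ ≤ 1 * ‖r‖ := by gcongr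
    linarith
  · change |kf w (ε⁻¹ • (u - w))| ≤ τ
    have h2 : kf w (u - w) = - ε * kf w r := by
      have := kf_add w w (u - w)
      rw [add_sub_cancel] at this
      linarith
    rw [kf_smul, h2]
    have h3 : ε⁻¹ * (-ε * kf w r) = - kf w r := by field_simp
    rw [h3, abs_neg]
    have := kf_abs w r
    linarith
  · intro k
    have h2 := h k
    have h3 := hweq k
    simp only [B_apply, lp.coeFn_add, lp.coeFn_sub, lp.coeFn_smul, Pi.add_apply, Pi.sub_apply, Pi.smul_apply,
        smul_eq_mul] at h2 h3 ⊢
    field_simp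
    linear_combination h2 - h3

end L2Z

theorem mathieu_sep_aux {c t lam : ℝ} (ht : t ∈ Set.Ioo (0 : ℝ) 1) {n : ℤ}
    (hn : c + 1 / 2 < n) (hc : 0 < c)
    (hp : |(2 * (n : ℝ) + t) ^ 2 - lam| ≤ 2 * c)
    (hq : |(2 * ((-1 - n : ℤ) : ℝ) + t) ^ 2 - lam| ≤ 2 * c)
    (k : ℤ) (hk1 : k ≠ n) (hk2 : k ≠ -1 - n) : 6 * c ≤ |(2 * (k : ℝ) + t) ^ 2 - lam| := by
  obtain ⟨ht0, ht1⟩ := ht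
  rw [abs_le] at hp hq
  push_cast at hq
  have hcases : n + 1 ≤ k ∨ k ≤ - n - 2 ∨ (-n ≤ k ∧ k ≤ n - 1) := by omega
  rcases hcases with h | h | ⟨h, h'⟩
  · have h : (n : ℝ) + 1 ≤ k := by exact_mod_cast h
    refine le_trans ?_ (le_abs_self _)
    nlinarith
  · have h : (k : ℝ) ≤ - n - 2 := by exact_mod_cast h
    refine le_trans ?_ (le_abs_self _)
    nlinarith
  · have h : -(n : ℝ) ≤ k := by exact_mod_cast h
    have h' : (k : ℝ) ≤ n - 1 := by exact_mod_cast h'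
    refine le_trans ?_ (neg_le_abs _)
    have : 0 ≤ ((k : ℝ) + n) * (n - 1 - k) := mul_nonneg (by linarith) (by linarith)
    nlinarith

theorem mathieu_ge {t M : ℝ} (ht : t ∈ Set.Ioo (0 : ℝ) 1) {n p : ℤ} (hn : 1 ≤ n)
    (hM : (2 * (n : ℝ) - 1) ^ 2 < M) (hp : M ≤ (2 * (p : ℝ) + t) ^ 2) : n ≤ p ∨ p ≤ -n := by
  obtain ⟨ht0, ht1⟩ := ht
  by_contra hcon
  push Not at hcon
  obtain ⟨h1, h2⟩ := hcon
  have h1' : (p : ℝ) ≤ n - 1 := by exact_mod_cast (by omega : p ≤ n - 1)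
  have h2' : -(n : ℝ) + 1 ≤ p := by exact_mod_cast (by omega : -n + 1 ≤ p)
  have : (2 * (p : ℝ) + t) ^ 2 ≤ (2 * (n : ℝ) - 1) ^ 2 := by
    apply sq_le_sq'
    · linarith
    · linarith
  linarith

theorem mathieu_sep {c t lam : ℝ} (ht : t ∈ Set.Ioo (0 : ℝ) 1) {n : ℤ}
    (hn : c + 1 / 2 < n) (hc : 0 < c) (hlam : (2 * (n : ℝ)) ^ 2 - 2 * c < lam) :
    ∀ p q : ℤ, Even p → Odd q → |(2 * (p : ℝ) + t) ^ 2 - lam| ≤ 2 * c →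
      |(2 * (q : ℝ) + t) ^ 2 - lam| ≤ 2 * c →
      ∀ k : ℤ, k ≠ p → k ≠ q → 6 * c ≤ |(2 * (k : ℝ) + t) ^ 2 - lam| := by
  intro p q hpe hqo hp hq k hkp hkq
  have hn1 : 1 ≤ n := by
    have : (0 : ℝ) < n := by linarith
    exact_mod_cast this
  have hM : (2 * (n : ℝ) - 1) ^ 2 < (2 * (n : ℝ)) ^ 2 - 4 * c := by nlinarith
  have hp' := abs_le.mp hp
  have hq' := abs_le.mp hq
  have h1 := mathieu_ge ht hn1 hM (p := p) (by linarith)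
  have h2 := mathieu_ge ht hn1 hM (p := q) (by linarith)
  have hpq : p + q ≠ 0 := by
    intro h
    have := hpe.add_odd hqo
    rw [h] at this
    simp at this
  have hpqne : p ≠ q := by
    rintro rfl
    exact (Int.not_even_iff_odd.mpr hqo) hpe
  have hd : ((p : ℝ) - q) * (p + q + t) < n - 1 / 2 := by nlinarith
  have hd' : -(n - 1 / 2) < ((p : ℝ) - q) * (p + q + t) := by nlinarith
  obtain ⟨ht0, ht1⟩ := ht
  have key : ∀ p q : ℤ, n ≤ p → (n ≤ q ∨ q ≤ -n) → p + q ≠ 0 → p ≠ q →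
      ((p : ℝ) - q) * (p + q + t) < n - 1 / 2 → -(n - 1 / 2) < ((p : ℝ) - q) * (p + q + t) →
      q = -1 - p := by
    intro p q h1 h2 hpq hne hd hd'
    have h1r : (n : ℝ) ≤ p := by exact_mod_cast h1
    rcases h2 with h2 | h2
    · exfalso
      have h2r : (n : ℝ) ≤ q := by exact_mod_cast h2
      rcases lt_or_gt_of_ne hne with h | h
      · have : (p : ℝ) + 1 ≤ q := by exact_mod_cast h
        nlinarith
      · have : (q : ℝ) + 1 ≤ p := by exact_mod_cast h
        nlinarith
    · have h2r : (q : ℝ) ≤ -n := by exact_mod_cast h2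
      by_contra hq
      rcases (by omega : p + q ≤ -2 ∨ 1 ≤ p + q) with h | h
      · have : (p : ℝ) + q ≤ -2 := by exact_mod_cast h
        nlinarith
      · have : (1 : ℝ) ≤ (p : ℝ) + q := by exact_mod_cast h
        nlinarith
  rcases h1 with h1 | h1
  · have := key p q h1 h2 hpq hpqne hd hd'
    subst this
    exact mathieu_sep_aux ⟨ht0, ht1⟩ (n := p) (lt_of_lt_of_le hn (by exact_mod_cast h1)) hc hp hq k hkp hkq
  · have h2' : n ≤ q := by
      rcases h2 with h2 | h2
      · exact h2
      · exfalso
        have h1r : (p : ℝ) ≤ -n := by exact_mod_cast h1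
        have h2r : (q : ℝ) ≤ -n := by exact_mod_cast h2
        rcases lt_or_gt_of_ne hpqne with h | h
        · have : (p : ℝ) + 1 ≤ q := by exact_mod_cast h
          nlinarith
        · have : (q : ℝ) + 1 ≤ p := by exact_mod_cast h
          nlinarith
    have := key q p h2' (Or.inr h1) (by omega) hpqne.symm (by nlinarith) (by nlinarith)
    subst this
    exact mathieu_sep_aux ⟨ht0, ht1⟩ (n := q) (lt_of_lt_of_le hn (by exact_mod_cast h2')) hc hq hp k hkq hkp

/-- the potential -/
noncomputable def mq (c : ℝ) (x : ℝ) : ℂ := 2 * Complex.I * (c : ℂ) * Complex.cos (2 * (x : ℂ))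

theorem mq_cont (c : ℝ) : Continuous (mq c) := by
  unfold mq; fun_prop

theorem mq_norm {c : ℝ} (hc : 0 < c) (x : ℝ) : ‖mq c x‖ ≤ 2 * c := by
  unfold mq
  have h : Complex.cos (2 * (x : ℂ)) = ((Real.cos (2 * x) : ℝ) : ℂ) := by push_cast; rfl
  rw [h]
  simp only [norm_mul, Complex.norm_real, Complex.norm_I, Real.norm_eq_abs, abs_of_pos hc]
  have := Real.abs_cos_le_one (2 * x)
  norm_num
  nlinarith

theorem mq_neg (c x : ℝ) : mq c (-x) = mq c x := by
  unfold mq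
  push_cast
  rw [mul_neg, Complex.cos_neg]

theorem mq_add (c x : ℝ) : mq c (x + Real.pi) = mq c x := by
  unfold mq
  push_cast
  rw [mul_add, Complex.cos_add_two_pi]

/-- solutions of the Mathieu equation, with their derivative -/
def MSol (c : ℝ) (μ : ℂ) (y y' : ℝ → ℂ) : Prop :=
  ∀ x, HasDerivAt y (y' x) x ∧ HasDerivAt y' ((mq c x - μ) * y x) x

theorem MSol.of_ode {c : ℝ} {μ : ℂ} {y : ℝ → ℂ} (hs : ContDiff ℝ 2 y)
    (h : ∀ x : ℝ, -(deriv (deriv y) x)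
        + 2 * Complex.I * (c : ℂ) * Complex.cos (2 * (x : ℂ)) * y x = μ * y x) :
    MSol c μ y (deriv y) := by
  intro x
  have h1 : ContDiff ℝ 1 (deriv y) := ((contDiff_succ_iff_deriv (n := 1)).mp hs).2.2
  refine ⟨((hs.differentiable (by norm_num)) x).hasDerivAt, ?_⟩
  have h2 := ((h1.differentiable (by norm_num)) x).hasDerivAt
  refine h2.congr_deriv ?_
  have := h x
  unfold mq
  linear_combination -this

theorem MSol.wronsk {c : ℝ} {μ : ℂ} {y y' z z' : ℝ → ℂ} (hy : MSol c μ y y') (hz : MSol c μ z z')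
    (x : ℝ) : y x * z' x - y' x * z x = y 0 * z' 0 - y' 0 * z 0 := by
  have hd : ∀ x, HasDerivAt (fun x => y x * z' x - y' x * z x) 0 x := by
    intro x
    have := ((hy x).1.mul (hz x).2).sub ((hy x).2.mul (hz x).1)
    refine this.congr_deriv ?_
    ring
  exact is_const_of_deriv_eq_zero (fun x => (hd x).differentiableAt) (fun x => (hd x).deriv) x 0

theorem MSol.repr {c : ℝ} {μ : ℂ} {θ θ' φ φ' u u' : ℝ → ℂ} (hθ : MSol c μ θ θ')
    (hφ : MSol c μ φ φ') (hu : MSol c μ u u') (h1 : θ 0 = 1) (h2 : θ' 0 = 0) (h3 : φ 0 = 0)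
    (h4 : φ' 0 = 1) (x : ℝ) : u x = u 0 * θ x + u' 0 * φ x := by
  have w1 := hu.wronsk hφ x
  have w2 := hθ.wronsk hu x
  have w3 := hθ.wronsk hφ x
  simp only [h1, h2, h3, h4] at w1 w2 w3
  linear_combination (-u x) * w3 + θ x * w1 + φ x * w2

theorem MSol.neg {c : ℝ} {μ : ℂ} {y y' : ℝ → ℂ} (hy : MSol c μ y y') :
    MSol c μ (fun x => y (-x)) (fun x => - y' (-x)) := by
  intro x
  have h := hy (-x)
  refine ⟨?_, ?_⟩
  · have := h.1.scomp x (hasDerivAt_neg x)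
    simpa [Function.comp_def] using this
  · have := (h.2.scomp x (hasDerivAt_neg x)).neg
    rw [mq_neg] at this
    refine this.congr_deriv ?_
    simp

theorem MSol.shift {c : ℝ} {μ : ℂ} {y y' : ℝ → ℂ} (hy : MSol c μ y y') :
    MSol c μ (fun x => y (x + Real.pi)) (fun x => y' (x + Real.pi)) := by
  intro x
  have h := hy (x + Real.pi)
  rw [mq_add] at h
  exact ⟨h.1.comp_add_const x Real.pi, h.2.comp_add_const x Real.pi⟩

theorem MSol.theta_sq {c : ℝ} {μ : ℂ} {θ θ' φ φ' : ℝ → ℂ} (hθ : MSol c μ θ θ')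
    (hφ : MSol c μ φ φ') (h1 : θ 0 = 1) (h2 : θ' 0 = 0) (h3 : φ 0 = 0)
    (h4 : φ' 0 = 1) (h0 : φ Real.pi = 0) : θ Real.pi ^ 2 = 1 := by
  have e1 : θ (-Real.pi) = θ Real.pi := by
    have := hθ.repr hφ hθ.neg h1 h2 h3 h4 Real.pi
    simpa [h1, h2] using this
  have e2 : φ (-Real.pi) = 0 := by
    have := hθ.repr hφ hφ.neg h1 h2 h3 h4 Real.pi
    simpa [h3, h4, h0] using this
  have e3 := hθ.repr hφ hθ.shift h1 h2 h3 h4 (-Real.pi)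
  simp only [neg_add_cancel, zero_add, e1, e2, h1, mul_zero, add_zero] at e3
  rw [sq]; exact e3.symm

theorem MSol.cont {c : ℝ} {μ : ℂ} {y y' : ℝ → ℂ} (hy : MSol c μ y y') : Continuous y :=
  continuous_iff_continuousAt.mpr fun x => (hy x).1.continuousAt

theorem MSol.close {c : ℝ} (hc : 0 < c) {lam : ℂ} {z z' : ℝ → ℂ} (hz : MSol c lam z z') :
    ∃ C : ℝ, 0 ≤ C ∧ ∀ (μ : ℂ) (y y' : ℝ → ℂ), ‖μ - lam‖ ≤ 1 → MSol c μ y y' → y 0 = z 0 → y' 0 = z' 0 →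
      ∀ x ∈ Set.Icc 0 Real.pi, ‖y x - z x‖ ≤ C * ‖μ - lam‖ := by
  obtain ⟨M, hM⟩ := isCompact_Icc.exists_bound_of_continuousOn (s := Set.Icc 0 Real.pi)
    hz.cont.continuousOn
  have hM0 : 0 ≤ M := (norm_nonneg _).trans (hM 0 ⟨le_rfl, Real.pi_pos.le⟩)
  set K := 2 * c + ‖lam‖ + 1 with hK
  have hKpos : 0 < K := by positivity
  have hK1 : 1 ≤ K := by have := norm_nonneg lam; linarith
  refine ⟨M / K * (Real.exp (K * Real.pi) - 1), ?_, ?_⟩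
  · have : 1 ≤ Real.exp (K * Real.pi) := Real.one_le_exp (by positivity)
    exact mul_nonneg (by positivity) (by linarith)
  intro μ y y' hμ hy h0 h0' x hx
  set d : ℝ → ℂ × ℂ := fun x => (y x - z x, y' x - z' x)
  set d' : ℝ → ℂ × ℂ := fun x => (y' x - z' x, (mq c x - μ) * y x - (mq c x - lam) * z x)
  have hd : ∀ x, HasDerivAt d (d' x) x := fun x =>
    ((hy x).1.sub (hz x).1).prodMk ((hy x).2.sub (hz x).2)
  have hμn : ‖μ‖ ≤ ‖lam‖ + 1 := by
    have := norm_add_le (μ - lam) lam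
    rw [sub_add_cancel] at this
    linarith
  have := norm_le_gronwallBound_of_norm_deriv_right_le (f := d) (f' := d') (δ := 0) (K := K)
    (ε := M * ‖μ - lam‖) (a := 0) (b := Real.pi)
    (fun x _ => (hd x).continuousAt.continuousWithinAt) (fun x _ => (hd x).hasDerivWithinAt)
    (by simp [d, h0, h0']) (by
      intro x hx
      have hMx := hM x ⟨hx.1, hx.2.le⟩
      have n1 : ‖y x - z x‖ ≤ ‖d x‖ := norm_fst_le (d x)
      have n2 : ‖y' x - z' x‖ ≤ ‖d x‖ := norm_snd_le (d x)
      have hnn : 0 ≤ M * ‖μ - lam‖ := by positivity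
      rw [Prod.norm_def]
      refine max_le ?_ ?_
      · show ‖y' x - z' x‖ ≤ _
        nlinarith [norm_nonneg (d x)]
      · show ‖(mq c x - μ) * y x - (mq c x - lam) * z x‖ ≤ _
        have e : (mq c x - μ) * y x - (mq c x - lam) * z x
          = (mq c x - μ) * (y x - z x) - (μ - lam) * z x := by ring
        rw [e]
        refine (norm_sub_le _ _).trans ?_
        rw [norm_mul, norm_mul]
        have h1 : ‖mq c x - μ‖ ≤ K := (norm_sub_le _ _).trans (by
          have := mq_norm hc x; linarith)
        have h2 : ‖mq c x - μ‖ * ‖y x - z x‖ ≤ K * ‖d x‖ := by gcongr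
        have h3 : ‖μ - lam‖ * ‖z x‖ ≤ ‖μ - lam‖ * M := by gcongr
        linarith) x hx
  have hfst : ‖y x - z x‖ ≤ ‖d x‖ := norm_fst_le (d x)
  refine hfst.trans (this.trans ?_)
  rw [gronwallBound_of_K_ne_0 hKpos.ne']
  simp only [zero_mul, zero_add, sub_zero]
  have hexp : Real.exp (K * x) ≤ Real.exp (K * Real.pi) := by
    apply Real.exp_le_exp.mpr
    have := hx.2
    gcongr
  have e : M / K * (Real.exp (K * Real.pi) - 1) * ‖μ - lam‖
    = M * ‖μ - lam‖ / K * (Real.exp (K * Real.pi) - 1) := by ring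
  rw [e]
  gcongr

/-- exponentials -/
noncomputable def mexp (t : ℝ) (k : ℤ) (x : ℝ) : ℂ :=
  Complex.exp (-(Complex.I * (2 * (k : ℂ) + (t : ℂ)) * (x : ℂ)))

theorem mexp_cont (t : ℝ) (k : ℤ) : Continuous (mexp t k) := by unfold mexp; fun_prop

/-- twisted Fourier coefficients -/
noncomputable def fc (t : ℝ) (f : ℝ → ℂ) (k : ℤ) : ℂ :=
  (Real.pi : ℂ)⁻¹ * ∫ x in (0 : ℝ)..Real.pi, mexp t k x * f x

theorem fc_eq (t : ℝ) (f : ℝ → ℂ) (k : ℤ) :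
    fc t f k = fourierCoeffOn Real.pi_pos (fun x => mexp t 0 x * f x) k := by
  rw [fourierCoeffOn_eq_integral, fc]
  simp only [sub_zero, Complex.real_smul]
  congr 1
  · push_cast; simp
  · apply intervalIntegral.integral_congr
    intro x _
    simp only [smul_eq_mul]
    rw [fourier_coe_apply, ← mul_assoc]
    congr 1
    unfold mexp
    rw [← Complex.exp_add]
    congr 1
    have : (Real.pi : ℂ) ≠ 0 := by exact_mod_cast Real.pi_ne_zero
    push_cast
    field_simp
    ring

theorem mexp_norm (t : ℝ) (k : ℤ) (x : ℝ) : ‖mexp t k x‖ = 1 := by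
  unfold mexp
  rw [Complex.norm_exp]
  simp

theorem fc_hasSum (t : ℝ) {f : ℝ → ℂ} (hf : Continuous f) :
    HasSum (fun k => ‖fc t f k‖ ^ 2) (Real.pi⁻¹ * ∫ x in (0 : ℝ)..Real.pi, ‖f x‖ ^ 2) := by
  have hc : Continuous fun x => mexp t 0 x * f x := (mexp_cont t 0).mul hf
  have h := hasSum_sq_fourierCoeffOn (f := fun x => mexp t 0 x * f x) Real.pi_pos (by
    have : MeasureTheory.MemLp (fun x => mexp t 0 x * f x) 2
        (MeasureTheory.volume.restrict (Set.Icc 0 Real.pi)) := by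
      obtain ⟨M, hM⟩ := isCompact_Icc.exists_bound_of_continuousOn (s := Set.Icc 0 Real.pi)
        hc.continuousOn
      exact MeasureTheory.MemLp.of_bound hc.aestronglyMeasurable M
        ((MeasureTheory.ae_restrict_mem measurableSet_Icc).mono hM)
    exact this.mono_measure (MeasureTheory.Measure.restrict_mono Set.Ioc_subset_Icc_self le_rfl))
  simp only [← fc_eq, norm_mul, mexp_norm, one_mul, sub_zero, smul_eq_mul] at h
  exact h

theorem fc_add (t : ℝ) {f g : ℝ → ℂ} (hf : Continuous f) (hg : Continuous g) (k : ℤ) :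
    fc t (fun x => f x + g x) k = fc t f k + fc t g k := by
  unfold fc
  rw [← mul_add, ← intervalIntegral.integral_add]
  · simp only [mul_add]
  · exact ((mexp_cont t k).mul hf).intervalIntegrable _ _
  · exact ((mexp_cont t k).mul hg).intervalIntegrable _ _

theorem fc_smul (t : ℝ) (a : ℂ) (f : ℝ → ℂ) (k : ℤ) :
    fc t (fun x => a * f x) k = a * fc t f k := by
  unfold fc
  have : ∀ x, mexp t k x * (a * f x) = a * (mexp t k x * f x) := fun x => by ring
  simp only [this]
  rw [intervalIntegral.integral_const_mul]
  ring

theorem fc_cos (t : ℝ) {f : ℝ → ℂ} (hf : Continuous f) (c : ℝ) (k : ℤ) :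
    fc t (fun x => mq c x * f x) k = Complex.I * c * (fc t f (k - 1) + fc t f (k + 1)) := by
  unfold fc
  rw [← mul_add, ← intervalIntegral.integral_add]
  · rw [mul_left_comm, ← intervalIntegral.integral_const_mul (Complex.I * (c : ℂ))]
    congr 1
    apply intervalIntegral.integral_congr
    intro x _
    have h : mexp t (k - 1) x * f x + mexp t (k + 1) x * f x
       = mexp t k x * (2 * Complex.cos (2 * (x : ℂ))) * f x := by
      rw [← add_mul]
      congr 1
      rw [Complex.two_cos]
      unfold mexp
      rw [mul_add (Complex.exp _), ← Complex.exp_add, ← Complex.exp_add]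
      congr 2 <;> push_cast <;> ring
    simp only [h]
    unfold mq
    ring
  · exact ((mexp_cont t _).mul hf).intervalIntegrable _ _
  · exact ((mexp_cont t _).mul hf).intervalIntegrable _ _

theorem mexp_hasDerivAt (t : ℝ) (k : ℤ) (x : ℝ) :
    HasDerivAt (mexp t k) (-(Complex.I * (2 * (k : ℂ) + (t : ℂ))) * mexp t k x) x := by
  unfold mexp
  have h1 : HasDerivAt (fun x : ℝ => -(Complex.I * (2 * (k : ℂ) + (t : ℂ)) * (x : ℂ)))
      (-(Complex.I * (2 * (k : ℂ) + (t : ℂ)) * 1)) x :=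
    ((Complex.ofRealCLM.hasDerivAt (x := x)).const_mul _).neg
  exact h1.cexp.congr_deriv (by ring)

theorem mexp_pi (t : ℝ) (k : ℤ) :
    mexp t k Real.pi * Complex.exp (Complex.I * (Real.pi : ℂ) * (t : ℂ)) = 1 := by
  unfold mexp
  rw [← Complex.exp_add, Complex.exp_eq_one_iff]
  exact ⟨-k, by push_cast; ring⟩

theorem fc_deriv2 (t : ℝ) {z z' z'' : ℝ → ℂ} (h1 : ∀ x, HasDerivAt z (z' x) x)
    (h2 : ∀ x, HasDerivAt z' (z'' x) x) (hc : Continuous z'')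
    (b1 : z Real.pi = Complex.exp (Complex.I * (Real.pi : ℂ) * (t : ℂ)) * z 0)
    (b2 : z' Real.pi = Complex.exp (Complex.I * (Real.pi : ℂ) * (t : ℂ)) * z' 0) (k : ℤ) :
    fc t z'' k = - (2 * (k : ℂ) + t) ^ 2 * fc t z k := by
  have hz : Continuous z := continuous_iff_continuousAt.mpr fun x => (h1 x).continuousAt
  set κ : ℂ := Complex.I * (2 * (k : ℂ) + (t : ℂ)) with hκ
  have hd : ∀ x ∈ Set.uIcc 0 Real.pi, HasDerivAt (fun x => mexp t k x * z' x + κ * (mexp t k x * z x))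
      (mexp t k x * z'' x + (2 * (k : ℂ) + t) ^ 2 * (mexp t k x * z x)) x := by
    intro x _
    have a1 := (mexp_hasDerivAt t k x).mul (h2 x)
    have a2 := ((mexp_hasDerivAt t k x).mul (h1 x)).const_mul κ
    refine (a1.add a2).congr_deriv ?_
    rw [hκ]
    linear_combination (-(2 * (k : ℂ) + t) ^ 2 * (mexp t k x * z x)) * Complex.I_sq
  have i1 : IntervalIntegrable (fun x => mexp t k x * z'' x) MeasureTheory.volume 0 Real.pi :=
    ((mexp_cont t k).mul hc).intervalIntegrable _ _
  have i2 : IntervalIntegrable (fun x => (2 * (k : ℂ) + t) ^ 2 * (mexp t k x * z x))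
      MeasureTheory.volume 0 Real.pi :=
    (continuous_const.mul ((mexp_cont t k).mul hz)).intervalIntegrable _ _
  have hintegral := intervalIntegral.integral_eq_sub_of_hasDerivAt hd (i1.add i2)
  rw [intervalIntegral.integral_add i1 i2, intervalIntegral.integral_const_mul] at hintegral
  have h0 : mexp t k 0 = 1 := by simp [mexp]
  have hpi := mexp_pi t k
  have hz0 : mexp t k Real.pi * z' Real.pi + κ * (mexp t k Real.pi * z Real.pi) -
      (mexp t k 0 * z' 0 + κ * (mexp t k 0 * z 0)) = 0 := by
    rw [b1, b2, h0]
    linear_combination (z' 0 + κ * z 0) * hpi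
  rw [hz0] at hintegral
  unfold fc
  linear_combination (Real.pi : ℂ)⁻¹ * hintegral

/-- the real sequence attached to a function -/
noncomputable def mS (ζ : ℂ) (hζ : ‖ζ‖ = 1) (t : ℝ) (f : C(ℝ, ℂ)) : L2Z :=
  ⟨fun k => (ζ * Complex.I ^ (-k) * fc t f k).re, L2Z.mem_of_summable (by
    refine Summable.of_nonneg_of_le (fun k => sq_nonneg _) (fun k => ?_)
      (fc_hasSum t f.continuous).summable
    rw [← sq_abs]
    gcongr
    refine (Complex.abs_re_le_norm _).trans ?_
    simp [hζ])⟩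

theorem mS_apply (ζ : ℂ) (hζ : ‖ζ‖ = 1) (t : ℝ) (f : C(ℝ, ℂ)) (k : ℤ) :
    mS ζ hζ t f k = (ζ * Complex.I ^ (-k) * fc t f k).re := rfl

theorem mS_sub (ζ : ℂ) (hζ : ‖ζ‖ = 1) (t : ℝ) (f g : C(ℝ, ℂ)) :
    mS ζ hζ t f - mS ζ hζ t g = mS ζ hζ t (f - g) := by
  ext k
  simp only [lp.coeFn_sub, Pi.sub_apply, mS_apply]
  have h : fc t (f - g : C(ℝ, ℂ)) k = fc t f k - fc t g k := by
    have h1 := fc_add t (f - g : C(ℝ, ℂ)).continuous g.continuous k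
    simp only [ContinuousMap.coe_sub, Pi.sub_apply, sub_add_cancel] at h1 ⊢
    exact eq_sub_of_add_eq h1.symm
  rw [h, mul_sub, Complex.sub_re]

theorem mS_norm (ζ : ℂ) (hζ : ‖ζ‖ = 1) (t : ℝ) (f : C(ℝ, ℂ)) {C : ℝ}
    (h : ∀ x ∈ Set.Icc 0 Real.pi, ‖f x‖ ≤ C) : ‖mS ζ hζ t f‖ ≤ C := by
  have hC : 0 ≤ C := (norm_nonneg _).trans (h 0 ⟨le_rfl, Real.pi_pos.le⟩)
  have h1 : ‖mS ζ hζ t f‖ ^ 2 ≤ Real.pi⁻¹ * ∫ x in (0 : ℝ)..Real.pi, ‖f x‖ ^ 2 := by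
    refine hasSum_le (fun k => ?_) (L2Z.sq_hasSum _) (fc_hasSum t f.continuous)
    rw [mS_apply, ← sq_abs]
    gcongr
    refine (Complex.abs_re_le_norm _).trans ?_
    simp [hζ]
  have h2 : ∫ x in (0 : ℝ)..Real.pi, ‖f x‖ ^ 2 ≤ ∫ x in (0 : ℝ)..Real.pi, C ^ 2 := by
    apply intervalIntegral.integral_mono_on Real.pi_pos.le
    · exact (f.continuous.norm.pow 2).intervalIntegrable _ _
    · exact continuous_const.intervalIntegrable _ _
    · intro x hx
      have := h x hx
      gcongr
  rw [intervalIntegral.integral_const, sub_zero, smul_eq_mul] at h2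
  have h3 : Real.pi⁻¹ * ∫ x in (0 : ℝ)..Real.pi, ‖f x‖ ^ 2 ≤ C ^ 2 := by
    rw [inv_mul_le_iff₀ Real.pi_pos]; exact h2
  exact (sq_le_sq₀ (norm_nonneg _) hC).mp (h1.trans h3)

theorem mS_eq (ζ : ℂ) (hζ : ‖ζ‖ = 1) (t c : ℝ) (μ : ℝ) (z f : C(ℝ, ℂ)) {z' z'' : ℝ → ℂ}
    (h1 : ∀ x, HasDerivAt z (z' x) x)
    (h2 : ∀ x, HasDerivAt z' (z'' x) x) (hc : Continuous z'')
    (b1 : z Real.pi = Complex.exp (Complex.I * (Real.pi : ℂ) * (t : ℂ)) * z 0)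
    (b2 : z' Real.pi = Complex.exp (Complex.I * (Real.pi : ℂ) * (t : ℂ)) * z' 0)
    (heq : ∀ x, - z'' x + mq c x * z x - μ * z x = f x) (k : ℤ) :
    ((2 * (k : ℝ) + t) ^ 2 - μ) * mS ζ hζ t z k + L2Z.B c (mS ζ hζ t z) k = mS ζ hζ t f k := by
  have e : (f : ℝ → ℂ) = fun x => (-1 : ℂ) * z'' x + (mq c x * z x + (-(μ : ℂ)) * z x) := by
    ext x; rw [← heq x]; ring
  have hf : fc t f k = ((2 * (k : ℂ) + t) ^ 2 - μ) * fc t z k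
      + Complex.I * c * (fc t z (k - 1) + fc t z (k + 1)) := by
    have c1 : Continuous fun x => mq c x * z x := (mq_cont c).mul z.continuous
    rw [e, fc_add t (by fun_prop) (by fun_prop), fc_add t c1 (by fun_prop), fc_smul, fc_smul,
      fc_cos t z.continuous, fc_deriv2 t h1 h2 hc b1 b2]
    ring
  rw [L2Z.B_apply]
  simp only [mS_apply]
  have hI := Complex.I_ne_zero
  have p1 : Complex.I ^ (-(k - 1)) = Complex.I ^ (-k) * Complex.I := by
    rw [show -(k - 1) = -k + 1 by ring, zpow_add₀ hI, zpow_one]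
  have p2 : Complex.I ^ (-(k + 1)) = - (Complex.I ^ (-k) * Complex.I) := by
    rw [show -(k + 1) = -k + (-1) by ring, zpow_add₀ hI, zpow_neg_one, Complex.inv_I]
    ring
  have main : ζ * Complex.I ^ (-k) * fc t f k
      = (((2 * (k : ℝ) + t) ^ 2 - μ : ℝ) : ℂ) * (ζ * Complex.I ^ (-k) * fc t z k)
        + (c : ℂ) * (ζ * Complex.I ^ (-(k - 1)) * fc t z (k - 1)
          - ζ * Complex.I ^ (-(k + 1)) * fc t z (k + 1)) := by
    rw [hf, p1, p2]
    push_cast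
    ring
  rw [main, Complex.add_re, Complex.re_ofReal_mul, Complex.re_ofReal_mul, Complex.sub_re]

theorem mS_ne (t : ℝ) (f : C(ℝ, ℂ)) (h : ∃ x ∈ Set.Icc 0 Real.pi, f x ≠ 0) :
    ∃ (ζ : ℂ) (hζ : ‖ζ‖ = 1), mS ζ hζ t f ≠ 0 := by
  by_contra hcon
  push Not at hcon
  have hz : ∀ k, fc t f k = 0 := by
    intro k
    have h1 := congrArg (fun w : L2Z => w k) (hcon 1 (by simp))
    have h2 := congrArg (fun w : L2Z => w k) (hcon Complex.I (by simp))
    simp only [mS_apply, lp.coeFn_zero, Pi.zero_apply, one_mul] at h1 h2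
    rw [mul_assoc, Complex.I_mul_re, neg_eq_zero] at h2
    have h3 : Complex.I ^ (-k) * fc t f k = 0 := Complex.ext h1 h2
    rcases mul_eq_zero.mp h3 with h4 | h4
    · exact absurd h4 (zpow_ne_zero _ Complex.I_ne_zero)
    · exact h4
  have hs := fc_hasSum t f.continuous
  simp only [hz, norm_zero] at hs
  have h0 : Real.pi⁻¹ * ∫ x in (0 : ℝ)..Real.pi, ‖f x‖ ^ 2 = 0 := hs.unique (by
    simp [hasSum_zero])
  obtain ⟨x, hx, hfx⟩ := h
  have hpos : 0 < ∫ x in (0 : ℝ)..Real.pi, ‖f x‖ ^ 2 :=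
    intervalIntegral.integral_pos Real.pi_pos (f.continuous.norm.pow 2).continuousOn
      (fun x _ => by positivity) ⟨x, hx, by positivity⟩
  have : 0 < Real.pi⁻¹ * ∫ x in (0 : ℝ)..Real.pi, ‖f x‖ ^ 2 := by
    have := Real.pi_pos
    positivity
  exact this.ne' h0

theorem delta_small {F : ℂ → ℂ} (hF : Differentiable ℂ F) {l : ℂ} (h1 : deriv F l = 0)
    (h2 : deriv (deriv F) l = 0) {η : ℝ} (hη : 0 < η) :
    ∃ r > 0, ∀ z, ‖z - l‖ ≤ r → ‖F z - F l‖ ≤ η * ‖z - l‖ ^ 2 := by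
  have hd : HasDerivAt (deriv F) 0 l := by
    rw [← h2]
    exact ((hF.contDiff (n := 2)).differentiable_deriv_two l).hasDerivAt
  have ho := (hasDerivAt_iff_isLittleO.mp hd).def hη
  obtain ⟨r, hr, hb⟩ := Metric.eventually_nhds_iff_ball.mp ho
  refine ⟨r / 2, by positivity, fun z hz => ?_⟩
  have := Convex.norm_image_sub_le_of_norm_deriv_le (f := F) (C := η * ‖z - l‖)
    (s := Metric.closedBall l ‖z - l‖) (x := l) (y := z) (fun x _ => hF x) (by
      intro x hx
      rw [Metric.mem_closedBall, dist_eq_norm] at hx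
      have h3 := hb x (by rw [Metric.mem_ball, dist_eq_norm]; linarith)
      simp only [h1, sub_zero, smul_zero] at h3
      exact h3.trans (by gcongr)) (convex_closedBall _ _) (by simp) (by simp [dist_eq_norm])
  exact this.trans (le_of_eq (by ring))

/-- boundary corrector -/
noncomputable def mg (x : ℝ) : ℂ := (x : ℂ) ^ 2 * ((x : ℂ) - Real.pi) / (Real.pi : ℂ) ^ 2
/-- its derivative -/
noncomputable def mg' (x : ℝ) : ℂ := (3 * (x : ℂ) ^ 2 - 2 * Real.pi * (x : ℂ)) / (Real.pi : ℂ) ^ 2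
/-- its second derivative -/
noncomputable def mg'' (x : ℝ) : ℂ := (6 * (x : ℂ) - 2 * Real.pi) / (Real.pi : ℂ) ^ 2

theorem mg_d (x : ℝ) : HasDerivAt mg (mg' x) x := by
  have h : HasDerivAt (fun x : ℝ => (x : ℂ)) 1 x := Complex.ofRealCLM.hasDerivAt (x := x)
  exact (((h.pow 2).mul (h.sub_const (Real.pi : ℂ))).div_const ((Real.pi : ℂ) ^ 2)).congr_deriv (by
    unfold mg'
    simp
    ring)

theorem mg_d' (x : ℝ) : HasDerivAt mg' (mg'' x) x := by
  have h : HasDerivAt (fun x : ℝ => (x : ℂ)) 1 x := Complex.ofRealCLM.hasDerivAt (x := x)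
  exact ((((h.pow 2).const_mul 3).sub (h.const_mul (2 * (Real.pi : ℂ)))).div_const
    ((Real.pi : ℂ) ^ 2)).congr_deriv (by
    unfold mg''
    simp
    ring)

theorem mg_cont : Continuous mg := by unfold mg; fun_prop
theorem mg_cont'' : Continuous mg'' := by unfold mg''; fun_prop

/-- quasi-periodic trial function -/
noncomputable def mz (ρ δ : ℂ) (θ φ : ℝ → ℂ) (x : ℝ) : ℂ :=
  φ Real.pi * θ x + (ρ - θ Real.pi) * φ x - ρ * δ * mg x

theorem mz_sys {c t : ℝ} {μ : ℝ} {δ : ℂ} {θ θ' φ φ' : ℝ → ℂ} (hθ : MSol c μ θ θ')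
    (hφ : MSol c μ φ φ') (h1 : θ 0 = 1) (h2 : θ' 0 = 0) (h3 : φ 0 = 0) (h4 : φ' 0 = 1)
    (hδ : φ' Real.pi + θ Real.pi = ((2 * Real.cos (Real.pi * t) : ℝ) : ℂ) + δ)
    (z f : C(ℝ, ℂ))
    (hz : ∀ x, z x = mz (Complex.exp (Complex.I * (Real.pi : ℂ) * (t : ℂ))) δ θ φ x)
    (hf : ∀ x, f x = -(Complex.exp (Complex.I * (Real.pi : ℂ) * (t : ℂ)) * δ) *
      (- mg'' x + mq c x * mg x - μ * mg x))
    (ζ : ℂ) (hζ : ‖ζ‖ = 1) (k : ℤ) :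
    ((2 * (k : ℝ) + t) ^ 2 - μ) * mS ζ hζ t z k + L2Z.B c (mS ζ hζ t z) k = mS ζ hζ t f k := by
  set ρ := Complex.exp (Complex.I * (Real.pi : ℂ) * (t : ℂ)) with hρ
  have hpi : (Real.pi : ℂ) ≠ 0 := by exact_mod_cast Real.pi_ne_zero
  have hcos : ρ ^ 2 + 1 = ρ * ((2 * Real.cos (Real.pi * t) : ℝ) : ℂ) := by
    push_cast
    rw [Complex.two_cos, hρ, mul_add, ← Complex.exp_add, ← Complex.exp_add, ← Complex.exp_nat_mul]
    congr 1
    · congr 1; push_cast; ring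
    · rw [eq_comm, Complex.exp_eq_one_iff]; exact ⟨0, by push_cast; ring⟩
  have hw := hθ.wronsk hφ Real.pi
  simp only [h1, h2, h3, h4] at hw
  have hzf : (z : ℝ → ℂ) = mz ρ δ θ φ := funext hz
  refine mS_eq ζ hζ t c μ z f
    (z' := fun x => φ Real.pi * θ' x + (ρ - θ Real.pi) * φ' x - ρ * δ * mg' x)
    (z'' := fun x => φ Real.pi * ((mq c x - μ) * θ x) + (ρ - θ Real.pi) * ((mq c x - μ) * φ x)
      - ρ * δ * mg'' x) ?_ ?_ ?_ ?_ ?_ ?_ k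
  · intro x
    rw [hzf]
    exact (((hθ x).1.const_mul _).add ((hφ x).1.const_mul _)).sub ((mg_d x).const_mul _)
  · intro x
    exact (((hθ x).2.const_mul _).add ((hφ x).2.const_mul _)).sub ((mg_d' x).const_mul _)
  · have a := mq_cont c
    have b := hθ.cont
    have d := hφ.cont
    have e := mg_cont''
    fun_prop
  · rw [hz, hz]
    simp only [mz, mg, h1, h3]
    simp
    ring
  · simp only [h2, h4, mg']
    have : (3 * (Real.pi : ℂ) ^ 2 - 2 * Real.pi * (Real.pi : ℂ)) / (Real.pi : ℂ) ^ 2 = 1 := by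
      field_simp; ring
    rw [this]
    simp
    linear_combination ρ * hδ - hw - hcos
  · intro x
    rw [hz, hf]
    simp only [mz]
    ring

theorem mz_ne {c t : ℝ} (ht : t ∈ Set.Ioo (0 : ℝ) 1) {μ : ℝ} {θ θ' φ φ' : ℝ → ℂ} (hθ : MSol c μ θ θ')
    (hφ : MSol c μ φ φ') (h1 : θ 0 = 1) (h2 : θ' 0 = 0) (h3 : φ 0 = 0) (h4 : φ' 0 = 1) :
    ∃ x ∈ Set.Icc 0 Real.pi, mz (Complex.exp (Complex.I * (Real.pi : ℂ) * (t : ℂ))) 0 θ φ x ≠ 0 := by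
  by_contra hcon
  push Not at hcon
  simp only [mz, mul_zero, zero_mul, sub_zero] at hcon
  have hpp := Real.pi_pos
  have e0 : φ Real.pi = 0 := by
    have := hcon 0 ⟨le_rfl, hpp.le⟩
    simpa [h1, h3] using this
  simp only [e0, zero_mul, zero_add] at hcon
  by_cases hr : Complex.exp (Complex.I * (Real.pi : ℂ) * (t : ℂ)) - θ Real.pi = 0
  · have hs := hθ.theta_sq hφ h1 h2 h3 h4 e0
    rw [← sub_eq_zero.mp hr, ← Complex.exp_nat_mul, Complex.exp_eq_one_iff] at hs
    obtain ⟨n, hn⟩ := hs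
    have hpi : (Real.pi : ℂ) ≠ 0 := by exact_mod_cast Real.pi_ne_zero
    have h5 : (t : ℂ) = (n : ℂ) := by
      have h6 : (2 * Real.pi * Complex.I : ℂ) * t = (2 * Real.pi * Complex.I : ℂ) * n := by
        push_cast at hn; linear_combination hn
      exact mul_left_cancel₀ (by simp [hpi]) h6
    have h7 : t = (n : ℝ) := by exact_mod_cast h5
    have a1 := ht.1
    have a2 := ht.2
    rw [h7] at a1 a2
    have b1 : 0 < n := by exact_mod_cast a1
    have b2 : n < 1 := by exact_mod_cast a2
    omega
  · have hz : ∀ x ∈ Set.Icc 0 Real.pi, φ x = 0 := fun x hx =>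
      (mul_eq_zero.mp (hcon x hx)).resolve_left hr
    have hev : φ =ᶠ[nhds (Real.pi / 2)] fun _ => 0 := by
      filter_upwards [Icc_mem_nhds (show 0 < Real.pi / 2 by linarith)
        (show Real.pi / 2 < Real.pi by linarith)] with x hx using hz x hx
    have hd : φ' (Real.pi / 2) = 0 := by
      have := ((hφ (Real.pi / 2)).1.congr_of_eventuallyEq hev.symm).unique (hasDerivAt_const _ (0 : ℂ))
      exact this
    have hw := hθ.wronsk hφ (Real.pi / 2)
    rw [hd, hz _ ⟨by linarith, by linarith⟩, h1, h2, h3, h4] at hw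
    simp at hw

theorem mz_close {c : ℝ} (hc : 0 < c) {θ θ' φ φ' : ℂ → ℝ → ℂ} (hθ : ∀ μ, MSol c μ (θ μ) (θ' μ))
    (hφ : ∀ μ, MSol c μ (φ μ) (φ' μ)) (h1 : ∀ μ, θ μ 0 = 1) (h2 : ∀ μ, θ' μ 0 = 0)
    (h3 : ∀ μ, φ μ 0 = 0) (h4 : ∀ μ, φ' μ 0 = 1) (l ρ : ℂ) (hρ : ‖ρ‖ = 1) :
    ∃ K : ℝ, 0 ≤ K ∧ ∀ μ δ : ℂ, ‖μ - l‖ ≤ 1 → ∀ x ∈ Set.Icc 0 Real.pi,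
      ‖mz ρ δ (θ μ) (φ μ) x - mz ρ 0 (θ l) (φ l) x‖ ≤ K * (‖μ - l‖ + ‖δ‖) := by
  obtain ⟨C1, hC1, k1⟩ := (hθ l).close hc
  obtain ⟨C2, hC2, k2⟩ := (hφ l).close hc
  obtain ⟨M1, hM1⟩ := isCompact_Icc.exists_bound_of_continuousOn (s := Set.Icc 0 Real.pi)
    (hθ l).cont.continuousOn
  obtain ⟨M2, hM2⟩ := isCompact_Icc.exists_bound_of_continuousOn (s := Set.Icc 0 Real.pi)
    (hφ l).cont.continuousOn
  obtain ⟨M3, hM3⟩ := isCompact_Icc.exists_bound_of_continuousOn (s := Set.Icc 0 Real.pi)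
    mg_cont.continuousOn
  have hpp := Real.pi_pos
  have z0 : (0 : ℝ) ∈ Set.Icc 0 Real.pi := ⟨le_rfl, hpp.le⟩
  have zp : Real.pi ∈ Set.Icc 0 Real.pi := ⟨hpp.le, le_rfl⟩
  have n1 : 0 ≤ M1 := (norm_nonneg _).trans (hM1 0 z0)
  have n2 : 0 ≤ M2 := (norm_nonneg _).trans (hM2 0 z0)
  have n3 : 0 ≤ M3 := (norm_nonneg _).trans (hM3 0 z0)
  refine ⟨C2 * (M1 + C1) + M2 * C1 + C1 * (M2 + C2) + (1 + M1) * C2 + M3, by positivity, ?_⟩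
  intro μ δ hμ x hx
  have a1 := k1 μ _ _ hμ (hθ μ) (by rw [h1, h1]) (by rw [h2, h2])
  have a2 := k2 μ _ _ hμ (hφ μ) (by rw [h3, h3]) (by rw [h4, h4])
  have bθ : ‖θ μ x‖ ≤ M1 + C1 := by
    have := norm_add_le (θ μ x - θ l x) (θ l x)
    rw [sub_add_cancel] at this
    have u := a1 x hx
    have v := hM1 x hx
    nlinarith
  have bφ : ‖φ μ x‖ ≤ M2 + C2 := by
    have := norm_add_le (φ μ x - φ l x) (φ l x)
    rw [sub_add_cancel] at this
    have u := a2 x hx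
    have v := hM2 x hx
    nlinarith
  have e : mz ρ δ (θ μ) (φ μ) x - mz ρ 0 (θ l) (φ l) x
      = (φ μ Real.pi - φ l Real.pi) * θ μ x + φ l Real.pi * (θ μ x - θ l x)
        - (θ μ Real.pi - θ l Real.pi) * φ μ x + (ρ - θ l Real.pi) * (φ μ x - φ l x)
        - ρ * δ * mg x := by
    unfold mz; ring
  have p1 : ‖(φ μ Real.pi - φ l Real.pi) * θ μ x‖ ≤ (C2 * ‖μ - l‖) * (M1 + C1) := by
    rw [norm_mul]; exact mul_le_mul (a2 _ zp) bθ (norm_nonneg _) (by positivity)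
  have p2 : ‖φ l Real.pi * (θ μ x - θ l x)‖ ≤ M2 * (C1 * ‖μ - l‖) := by
    rw [norm_mul]; exact mul_le_mul (hM2 _ zp) (a1 _ hx) (norm_nonneg _) (by positivity)
  have p3 : ‖(θ μ Real.pi - θ l Real.pi) * φ μ x‖ ≤ (C1 * ‖μ - l‖) * (M2 + C2) := by
    rw [norm_mul]; exact mul_le_mul (a1 _ zp) bφ (norm_nonneg _) (by positivity)
  have p4 : ‖(ρ - θ l Real.pi) * (φ μ x - φ l x)‖ ≤ (1 + M1) * (C2 * ‖μ - l‖) := by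
    rw [norm_mul]
    refine mul_le_mul ((norm_sub_le _ _).trans ?_) (a2 _ hx) (norm_nonneg _) (by positivity)
    rw [hρ]
    linarith [hM1 _ zp]
  have p5 : ‖ρ * δ * mg x‖ ≤ ‖δ‖ * M3 := by
    rw [norm_mul, norm_mul, hρ, one_mul]
    exact mul_le_mul_of_nonneg_left (hM3 x hx) (norm_nonneg _)
  rw [e]
  refine (norm_sub_le _ _).trans ?_
  have q1 := norm_add_le ((φ μ Real.pi - φ l Real.pi) * θ μ x + φ l Real.pi * (θ μ x - θ l x)
        - (θ μ Real.pi - θ l Real.pi) * φ μ x) ((ρ - θ l Real.pi) * (φ μ x - φ l x))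
  have q2 := norm_sub_le ((φ μ Real.pi - φ l Real.pi) * θ μ x + φ l Real.pi * (θ μ x - θ l x))
        ((θ μ Real.pi - θ l Real.pi) * φ μ x)
  have q3 := norm_add_le ((φ μ Real.pi - φ l Real.pi) * θ μ x) (φ l Real.pi * (θ μ x - θ l x))
  have r1 : 0 ≤ (C2 * (M1 + C1) + M2 * C1 + C1 * (M2 + C2) + (1 + M1) * C2) * ‖δ‖ := by positivity
  have r2 : 0 ≤ M3 * ‖μ - l‖ := by positivity
  nlinarith

theorem mathieu_final (c : ℝ) (hc : 0 < c)
    (θ φ : ℂ → ℝ → ℂ)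
    (hθsmooth : ∀ lam : ℂ, ContDiff ℝ 2 (θ lam))
    (hφsmooth : ∀ lam : ℂ, ContDiff ℝ 2 (φ lam))
    (hθode : ∀ lam : ℂ, ∀ x : ℝ,
      -(deriv (deriv (θ lam)) x)
        + 2 * Complex.I * (c : ℂ) * Complex.cos (2 * (x : ℂ)) * θ lam x = lam * θ lam x)
    (hφode : ∀ lam : ℂ, ∀ x : ℝ,
      -(deriv (deriv (φ lam)) x)
        + 2 * Complex.I * (c : ℂ) * Complex.cos (2 * (x : ℂ)) * φ lam x = lam * φ lam x)
    (hθinit : ∀ lam : ℂ, θ lam 0 = 1 ∧ deriv (θ lam) 0 = 0)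
    (hφinit : ∀ lam : ℂ, φ lam 0 = 0 ∧ deriv (φ lam) 0 = 1)
    (F : ℂ → ℂ)
    (hF : ∀ lam : ℂ, F lam = deriv (φ lam) Real.pi + θ lam Real.pi)
    (hFentire : Differentiable ℂ F)
    (n₃ : ℤ) (hn₃ : n₃ = ⌊(2 * c + 1) / 2⌋ + 1)
    (t : ℝ) (ht : t ∈ Set.Ioo (0 : ℝ) 1)
    (lam : ℝ) (hlam : lam > (2 * (n₃ : ℝ)) ^ 2 - 2 * c)
    (hev : F (lam : ℂ) = ((2 * Real.cos (Real.pi * t) : ℝ) : ℂ)) :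
    ¬ (deriv F (lam : ℂ) = 0 ∧ deriv (deriv F) (lam : ℂ) = 0) := by
  rintro ⟨hF1, hF2⟩
  have hθ : ∀ μ, MSol c μ (θ μ) (deriv (θ μ)) := fun μ => MSol.of_ode (hθsmooth μ) (hθode μ)
  have hφ : ∀ μ, MSol c μ (φ μ) (deriv (φ μ)) := fun μ => MSol.of_ode (hφsmooth μ) (hφode μ)
  have h1 := fun μ => (hθinit μ).1
  have h2 := fun μ => (hθinit μ).2
  have h3 := fun μ => (hφinit μ).1
  have h4 := fun μ => (hφinit μ).2
  have hn : c + 1 / 2 < (n₃ : ℝ) := by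
    have := Int.lt_floor_add_one ((2 * c + 1) / 2)
    rw [hn₃]; push_cast; linarith
  have hsep := mathieu_sep ht hn hc hlam
  set ρ := Complex.exp (Complex.I * (Real.pi : ℂ) * (t : ℂ)) with hρ
  have hρ1 : ‖ρ‖ = 1 := by rw [hρ, Complex.norm_exp]; simp
  have hcz : ∀ μ δ, Continuous (mz ρ δ (θ μ) (φ μ)) := by
    intro μ δ
    have a := (hθ μ).cont
    have b := (hφ μ).cont
    have d := mg_cont
    unfold mz
    fun_prop
  set Z : ℂ → ℂ → C(ℝ, ℂ) := fun μ δ => ⟨mz ρ δ (θ μ) (φ μ), hcz μ δ⟩ with hZ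
  obtain ⟨ζ, hζ, hne⟩ := mS_ne t (Z lam 0) (mz_ne ht (hθ lam) (hφ lam) (h1 _) (h2 _) (h3 _) (h4 _))
  obtain ⟨K, hK, hclose⟩ := mz_close hc hθ hφ h1 h2 h3 h4 lam ρ hρ1
  have hG : ∀ μ : ℝ, Continuous fun x => - mg'' x + mq c x * mg x - μ * mg x := by
    intro μ
    have a := mq_cont c
    have b := mg_cont
    have d := mg_cont''
    fun_prop
  set f : ℝ → ℂ → C(ℝ, ℂ) := fun μ δ =>
    ⟨fun x => -(ρ * δ) * (- mg'' x + mq c x * mg x - μ * mg x), continuous_const.mul (hG μ)⟩ with hf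
  have hsys : ∀ (μ : ℝ) (δ : ℂ), F μ = F lam + δ → ∀ k : ℤ,
      ((2 * (k : ℝ) + t) ^ 2 - μ) * mS ζ hζ t (Z μ δ) k + L2Z.B c (mS ζ hζ t (Z μ δ)) k
        = mS ζ hζ t (f μ δ) k := by
    intro μ δ hδ k
    refine mz_sys (hθ μ) (hφ μ) (h1 _) (h2 _) (h3 _) (h4 _) ?_ (Z μ δ) (f μ δ) (fun x => rfl)
      (fun x => rfl) ζ hζ k
    rw [← hF, hδ, hev]
  obtain ⟨M1, hM1⟩ := isCompact_Icc.exists_bound_of_continuousOn (s := Set.Icc 0 Real.pi)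
    mg_cont.continuousOn
  obtain ⟨M2, hM2⟩ := isCompact_Icc.exists_bound_of_continuousOn (s := Set.Icc 0 Real.pi)
    mg_cont''.continuousOn
  have z0 : (0 : ℝ) ∈ Set.Icc 0 Real.pi := ⟨le_rfl, Real.pi_pos.le⟩
  have n1 : 0 ≤ M1 := (norm_nonneg _).trans (hM1 0 z0)
  have n2 : 0 ≤ M2 := (norm_nonneg _).trans (hM2 0 z0)
  set N := M2 + 2 * c * M1 + (|lam| + 1) * M1 with hN
  have hN0 : 0 ≤ N := by positivity
  have hfn : ∀ (μ : ℝ) (δ : ℂ), |μ - lam| ≤ 1 → ‖mS ζ hζ t (f μ δ)‖ ≤ ‖δ‖ * N := by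
    intro μ δ hμ
    apply mS_norm
    intro x hx
    show ‖-(ρ * δ) * (- mg'' x + mq c x * mg x - μ * mg x)‖ ≤ _
    rw [norm_mul, norm_neg, norm_mul, hρ1, one_mul]
    refine mul_le_mul_of_nonneg_left ?_ (norm_nonneg _)
    have a1 := norm_sub_le (- mg'' x + mq c x * mg x) ((μ : ℂ) * mg x)
    have a2 := norm_add_le (- mg'' x) (mq c x * mg x)
    rw [norm_mul, Complex.norm_real, Real.norm_eq_abs] at a1
    rw [norm_neg, norm_mul] at a2
    have a3 : |μ| ≤ |lam| + 1 := by
      have := abs_add_le (μ - lam) lam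
      rw [sub_add_cancel] at this
      linarith
    have a4 : |μ| * ‖mg x‖ ≤ (|lam| + 1) * M1 :=
      mul_le_mul a3 (hM1 x hx) (norm_nonneg _) (by positivity)
    have a5 : ‖mq c x‖ * ‖mg x‖ ≤ 2 * c * M1 :=
      mul_le_mul (mq_norm hc x) (hM1 x hx) (norm_nonneg _) (by positivity)
    linarith [hM2 x hx]
  refine L2Z.family hc hsep hne ?_ ?_
  · intro k
    have := hsys lam 0 (by simp) k
    rw [this]
    have hz : f lam 0 = 0 := by ext x; simp [hf]
    rw [hz, mS_apply]
    simp [fc]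
  · intro τ hτ
    obtain ⟨r, hr, hsm⟩ := delta_small hFentire hF1 hF2
      (η := min 1 (τ / (N + 1))) (lt_min one_pos (by positivity))
    set ε : ℝ := min (min 1 τ) (min r (τ / (2 * K + 1))) with hε
    have hε0 : 0 < ε := by
      rw [hε]; exact lt_min (lt_min one_pos hτ) (lt_min hr (by positivity))
    have e1 : ε ≤ 1 := (min_le_left _ _).trans (min_le_left _ _)
    have e2 : ε ≤ τ := (min_le_left _ _).trans (min_le_right _ _)
    have e3 : ε ≤ r := (min_le_right _ _).trans (min_le_left _ _)
    have e4 : ε * (2 * K + 1) ≤ τ := by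
      rw [← le_div_iff₀ (by positivity)]
      exact (min_le_right _ _).trans (min_le_right _ _)
    have hnε : ‖((lam + ε : ℝ) : ℂ) - (lam : ℂ)‖ = ε := by
      rw [← Complex.ofReal_sub, Complex.norm_real, add_sub_cancel_left, Real.norm_eq_abs,
        abs_of_pos hε0]
    set δ : ℂ := F ((lam + ε : ℝ) : ℂ) - F lam with hδ
    have hδn := hsm ((lam + ε : ℝ) : ℂ) (by rw [hnε]; exact e3)
    rw [hnε, ← hδ] at hδn
    have hδ1 : ‖δ‖ ≤ ε := by
      have : min 1 (τ / (N + 1)) * ε ^ 2 ≤ 1 * ε ^ 2 := by gcongr; exact min_le_left _ _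
      nlinarith
    have hδ2 : ‖δ‖ * N ≤ τ * ε ^ 2 := by
      have h5 : min 1 (τ / (N + 1)) * ε ^ 2 ≤ τ / (N + 1) * ε ^ 2 := by
        gcongr; exact min_le_right _ _
      have h6 : ‖δ‖ * (N + 1) ≤ τ / (N + 1) * ε ^ 2 * (N + 1) := by
        gcongr; exact hδn.trans h5
      have h7 : τ / (N + 1) * ε ^ 2 * (N + 1) = τ * ε ^ 2 := by field_simp
      nlinarith [norm_nonneg δ]
    refine ⟨ε, hε0.ne', by rw [abs_of_pos hε0]; exact e2, mS ζ hζ t (Z (lam + ε : ℝ) δ),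
      (ε ^ 2)⁻¹ • mS ζ hζ t (f (lam + ε) δ), ?_, ?_, ?_⟩
    · rw [mS_sub]
      apply mS_norm
      intro x hx
      refine (hclose ((lam + ε : ℝ) : ℂ) δ (by rw [hnε]; exact e1) x hx).trans ?_
      rw [hnε]
      nlinarith
    · rw [norm_smul, Real.norm_eq_abs, abs_of_pos (by positivity),
        inv_mul_le_iff₀ (by positivity)]
      refine (hfn (lam + ε) δ (by rw [add_sub_cancel_left, abs_of_pos hε0]; exact e1)).trans ?_
      linarith
    · intro k
      have h5 := hsys (lam + ε) δ (by rw [hδ]; ring) k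
      have h6 : ((ε ^ 2)⁻¹ • mS ζ hζ t (f (lam + ε) δ) : L2Z) k
        = (ε ^ 2)⁻¹ * mS ζ hζ t (f (lam + ε) δ) k := rfl
      rw [h6, ← mul_assoc, mul_inv_cancel₀ (by positivity), one_mul, ← h5]
      ring

/-- Eigenvalues of `H_t(c)`, `t ∈ (0,1)`, lying in `((2n₃)² − 2c, ∞)` have
multiplicity less than 3: `F(λ) = 2cos(πt)` implies `F'(λ)` and `F''(λ)` do not
both vanish. -/
theorem stmt9 (c : ℝ) (hc : 0 < c)
    (θ φ : ℂ → ℝ → ℂ)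
    (hθsmooth : ∀ lam : ℂ, ContDiff ℝ 2 (θ lam))
    (hφsmooth : ∀ lam : ℂ, ContDiff ℝ 2 (φ lam))
    (hθode : ∀ lam : ℂ, ∀ x : ℝ,
      -(deriv (deriv (θ lam)) x)
        + 2 * Complex.I * (c : ℂ) * Complex.cos (2 * (x : ℂ)) * θ lam x = lam * θ lam x)
    (hφode : ∀ lam : ℂ, ∀ x : ℝ,
      -(deriv (deriv (φ lam)) x)
        + 2 * Complex.I * (c : ℂ) * Complex.cos (2 * (x : ℂ)) * φ lam x = lam * φ lam x)
    (hθinit : ∀ lam : ℂ, θ lam 0 = 1 ∧ deriv (θ lam) 0 = 0)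
    (hφinit : ∀ lam : ℂ, φ lam 0 = 0 ∧ deriv (φ lam) 0 = 1)
    (F : ℂ → ℂ)
    (hF : ∀ lam : ℂ, F lam = deriv (φ lam) Real.pi + θ lam Real.pi)
    (hFentire : Differentiable ℂ F)
    (n₃ : ℤ) (hn₃ : n₃ = ⌊(2 * c + 1) / 2⌋ + 1)
    (t : ℝ) (ht : t ∈ Set.Ioo (0 : ℝ) 1)
    (lam : ℝ) (hlam : lam > (2 * (n₃ : ℝ)) ^ 2 - 2 * c)
    (hev : F (lam : ℂ) = ((2 * Real.cos (Real.pi * t) : ℝ) : ℂ)) :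
    ¬ (deriv F (lam : ℂ) = 0 ∧ deriv (deriv F) (lam : ℂ) = 0) := by
  exact mathieu_final c hc θ φ hθsmooth hφsmooth hθode hφode hθinit hφinit F hF hFentire n₃ hn₃ t ht
    lam hlam hev
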